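/- Let l ≥ 2 and let J = (j_1, …, j_s) be a strictly increasing finite sequence of natural numbers with 1 ≤ j_k ≤ l−1 for all k. Then for every natural number n, D(J, n) ≤ 2^{l−1}·(l−2) + 1 + 2^{l−1}·n. -/

import Mathlib

/-- `D (J, n)`: the homological dimension of the iterated lower-indexed Dyer–Lashof
operation `Q_{j_1} ⋯ Q_{j_s}` applied to a class of dimension `n`, defined by the
right fold `D((), n) = n`, `D((j) ++ J', n) = j + 2·D(J', n)`. -/
def lowerDim (J : List ℕ) (n : ℕ) : ℕ := J.foldr (fun j acc => j + 2 * acc) n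

theorem lowerDim_aux (n d : ℕ) : ∀ (a : ℕ) (J : List ℕ), J.Pairwise (· < ·) →
    (∀ j ∈ J, a + 1 ≤ j ∧ j ≤ a + d) →
    lowerDim J n + a + 2 ^ d ≤ 2 ^ d * (a + d + n) + 1 := by
  induction d with
  | zero =>
    intro a J _ hb
    cases J with
    | nil => simp [lowerDim]; omega
    | cons j J => have := hb j (by simp); omega
  | succ d ih =>
    intro a J hp hb
    have hpos : 1 ≤ 2 ^ d := Nat.one_le_two_pow
    have easy : (∀ j ∈ J, a + 1 + 1 ≤ j) →
        lowerDim J n + a + 2 ^ (d + 1) ≤ 2 ^ (d + 1) * (a + (d + 1) + n) + 1 := by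
      intro h
      have := ih (a + 1) J hp (fun j hj => ⟨h j hj, by have := hb j hj; omega⟩)
      rw [pow_succ]
      nlinarith [Nat.zero_le (2 ^ d * (a + d + n))]
    cases J with
    | nil => exact easy (by simp)
    | cons j J =>
      rw [List.pairwise_cons] at hp
      have hj := hb j (by simp)
      by_cases hja : j = a + 1
      · have := ih (a + 1) J hp.2 (fun k hk => by
          have h1 := hp.1 k hk
          have h2 := hb k (by simp [hk])
          omega)
        have e : lowerDim (j :: J) n = j + 2 * lowerDim J n := rfl
        rw [e, pow_succ]
        nlinarith
      · refine easy (fun k hk => ?_)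
        rcases List.mem_cons.1 hk with rfl | hk
        · omega
        · have := hp.1 k hk
          omega

/-- For `l ≥ 2` and a strictly increasing sequence `J` with entries in `[1, l−1]`,
`D(J, n) ≤ 2^{l−1}·(l−2) + 1 + 2^{l−1}·n` for every `n`. -/
theorem lowerDim_le_of_strict_incr (l : ℕ) (hl : 2 ≤ l) (J : List ℕ)
    (hstrict : List.Chain' (· < ·) J)
    (hbounds : ∀ j ∈ J, 1 ≤ j ∧ j ≤ l - 1) (n : ℕ) :
    lowerDim J n ≤ 2 ^ (l - 1) * (l - 2) + 1 + 2 ^ (l - 1) * n := by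
  have h := lowerDim_aux n (l - 1) 0 J (List.isChain_iff_pairwise.1 hstrict)
    (fun j hj => by have := hbounds j hj; omega)
  obtain ⟨m, rfl⟩ := Nat.exists_eq_add_of_le hl
  have e1 : 2 + m - 1 = m + 1 := by omega
  have e2 : 2 + m - 2 = m := by omega
  rw [e1] at h ⊢
  rw [e2]
  nlinarith
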